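/- Let N ≥ 2 be an integer, p a real with 1 < p < N and α ≥ 0. Define g(r) := r^{(p+α)/(p(p−1))} · (1 + r^{(p+α)/(p−1)})^{−(N+α)/(p+α)} and λ(α) := (p+α)(Np+pα−p−α)/p². Then the function r ↦ r^{N−1} (−U_α'(r))^{p−2} g'(r) is differentiable on (0,∞) and for every r > 0: −(p−1) · d/dr [ r^{N−1} (−U_α'(r))^{p−2} g'(r) ] + λ(α) · r^{N−3} (−U_α'(r))^{p−2} g(r) = (p*_α − 1) r^{N+α−1} U_α(r)^{p*_α−2} g(r). (That is, g is the radial part of an eigenfunction of the linearized operator at U_α associated with the angular eigenvalue λ(α) of the Laplace–Beltrami operator on the sphere.) -/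

import Mathlib

open MeasureTheory Real

noncomputable section

/-- The critical Hénon exponent `p*_α = p(N+α)/(N-p)`. -/
def pS (N p α : ℝ) : ℝ := p * (N + α) / (N - p)

/-- The normalizing constant `C_{N,p,α}`. -/
def Cnpa (N p α : ℝ) : ℝ :=
  ((N + α) * ((N - p) / (p - 1)) ^ (p - 1)) ^ ((N - p) / (p * (p + α)))

/-- The radial profile `U_α(r)` of the standard solution. -/
def Urad (N p α r : ℝ) : ℝ :=
  Cnpa N p α * (1 + r ^ ((p + α) / (p - 1))) ^ (-((N - p) / (p + α)))

/-- Derivative of `x ^ c * (1 + x ^ b) ^ d` at a positive point. -/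
lemma hasDerivAt_rpow_mul_one_add_rpow (b c d : ℝ) {x : ℝ} (hx : 0 < x) :
    HasDerivAt (fun y : ℝ => y ^ c * (1 + y ^ b) ^ d)
      (x ^ (c - 1) * (1 + x ^ b) ^ (d - 1) * (c * (1 + x ^ b) + d * b * x ^ b)) x := by
  have hs : 0 < 1 + x ^ b := by positivity
  have h1 : HasDerivAt (fun y : ℝ => y ^ c) (c * x ^ (c - 1)) x :=
    Real.hasDerivAt_rpow_const (Or.inl hx.ne')
  have h2 : HasDerivAt (fun y : ℝ => 1 + y ^ b) (b * x ^ (b - 1)) x :=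
    (Real.hasDerivAt_rpow_const (Or.inl hx.ne')).const_add 1
  refine (h1.mul (h2.rpow_const (p := d) (Or.inl hs.ne'))).congr_deriv ?_
  have e1 : x ^ c = x ^ (c - 1) * x := by
    rw [← Real.rpow_add_one hx.ne']; ring_nf
  have e2 : x ^ b = x ^ (b - 1) * x := by
    rw [← Real.rpow_add_one hx.ne']; ring_nf
  have e3 : (1 + x ^ b) ^ d = (1 + x ^ b) ^ (d - 1) * (1 + x ^ b) := by
    rw [← Real.rpow_add_one hs.ne']; ring_nf
  rw [e1, e3]
  generalize (1 + x ^ b) ^ (d - 1) = w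
  rw [e2]
  ring

lemma Cnpa_pos {N p α : ℝ} (hp : 1 < p) (hpN : p < N) (hα : 0 ≤ α) : 0 < Cnpa N p α := by
  have h1 : 0 < p - 1 := by linarith
  have h2 : 0 < N - p := by linarith
  have h3 : 0 < N + α := by linarith
  unfold Cnpa
  positivity

lemma Cnpa_rpow_pS_sub {N p α : ℝ} (hp : 1 < p) (hpN : p < N) (hα : 0 ≤ α) :
    Cnpa N p α ^ (pS N p α - p) = (N + α) * ((N - p) / (p - 1)) ^ (p - 1) := by
  have h1 : 0 < p - 1 := by linarith
  have h2 : 0 < N - p := by linarith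
  have h3 : 0 < N + α := by linarith
  have h4 : 0 < p + α := by linarith
  have h5 : 0 < p := by linarith
  unfold Cnpa pS
  rw [← Real.rpow_mul (by positivity)]
  have : (N - p) / (p * (p + α)) * (p * (N + α) / (N - p) - p) = 1 := by
    field_simp
    ring
  rw [this, Real.rpow_one]

lemma deriv_Urad {N p α r : ℝ} (hp : 1 < p) (hα : 0 ≤ α) (hr : 0 < r) :
    deriv (Urad N p α) r = -(Cnpa N p α * ((N - p) / (p - 1)) *
      (r ^ ((p + α) / (p - 1) - 1) *
        (1 + r ^ ((p + α) / (p - 1))) ^ (-((N + α) / (p + α))))) := by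
  have h1 : p - 1 ≠ 0 := by linarith
  have h4 : p + α ≠ 0 := by linarith
  have hs : (1 + r ^ ((p + α) / (p - 1))) ≠ 0 := by positivity
  have h2 : HasDerivAt (fun y : ℝ => 1 + y ^ ((p + α) / (p - 1)))
      ((p + α) / (p - 1) * r ^ ((p + α) / (p - 1) - 1)) r :=
    (Real.hasDerivAt_rpow_const (Or.inl hr.ne')).const_add 1
  have h3 : HasDerivAt (Urad N p α) _ r :=
    (h2.rpow_const (p := -((N - p) / (p + α))) (Or.inl hs)).const_mul (Cnpa N p α)
  rw [h3.deriv]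
  have e : -((N - p) / (p + α)) - 1 = -((N + α) / (p + α)) := by field_simp; ring
  rw [e]
  field_simp

/-- Closed form of the flux `x ^ (N-1) * (-U_α') ^ (p-2) * g'`, with `A = C_{N,p,α} (N-p)/(p-1)`,
`b = (p+α)/(p-1)` and `k = (N+α)/(p+α)`. -/
lemma flux_eq (N p a b k A : ℝ) {x : ℝ} (hA : 0 < A) (hx : 0 < x) :
    x ^ (N - 1) * (A * (x ^ (b - 1) * (1 + x ^ b) ^ (-k))) ^ (p - 2) *
      (x ^ (a - 1) * (1 + x ^ b) ^ (-k - 1) * (a * (1 + x ^ b) + -k * b * x ^ b)) =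
    A ^ (p - 2) * (a * (x ^ (N - 2 + (b - 1) * (p - 2) + a) *
        (1 + x ^ b) ^ (-(k * (p - 1)) - 1)) +
      (a - k * b) * (x ^ (N - 2 + (b - 1) * (p - 2) + a + b) *
        (1 + x ^ b) ^ (-(k * (p - 1)) - 1))) := by
  have hs : 0 < 1 + x ^ b := by positivity
  rw [Real.mul_rpow hA.le (by positivity), Real.mul_rpow (by positivity) (by positivity),
    ← Real.rpow_mul hx.le, ← Real.rpow_mul hs.le]
  have e1 : x ^ (N - 2 + (b - 1) * (p - 2) + a) =
      x ^ (N - 1) * x ^ ((b - 1) * (p - 2)) * x ^ (a - 1) := by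
    rw [← Real.rpow_add hx, ← Real.rpow_add hx]; ring_nf
  have e2 : (1 + x ^ b) ^ (-(k * (p - 1)) - 1) =
      (1 + x ^ b) ^ (-k * (p - 2)) * (1 + x ^ b) ^ (-k - 1) := by
    rw [← Real.rpow_add hs]; ring_nf
  rw [Real.rpow_add hx _ b, e1, e2]
  ring

/-- The function
`g(r) = r^{(p+α)/(p(p-1))} (1 + r^{(p+α)/(p-1)})^{-(N+α)/(p+α)}` is the radial part of an
eigenfunction of the linearized operator at `U_α` associated with the angular eigenvalue
`λ(α) = (p+α)(Np+pα-p-α)/p²`:  `r ↦ r^{N-1}(-U_α'(r))^{p-2} g'(r)` is differentiable on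
`(0,∞)` and
`-(p-1) d/dr[r^{N-1}(-U_α')^{p-2} g'] + λ(α) r^{N-3}(-U_α')^{p-2} g
  = (p*_α-1) r^{N+α-1} U_α^{p*_α-2} g`. -/
theorem stmt_3 (N : ℕ) (hN : 2 ≤ N) (p α : ℝ) (hp1 : 1 < p) (hpN : p < N) (hα : 0 ≤ α) :
    ∀ g F : ℝ → ℝ,
      (g = fun r => r ^ ((p + α) / (p * (p - 1))) *
        (1 + r ^ ((p + α) / (p - 1))) ^ (-(((N : ℝ) + α) / (p + α)))) →
      (F = fun r => r ^ ((N : ℝ) - 1) * (-(deriv (Urad N p α) r)) ^ (p - 2) * deriv g r) →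
      ∀ r : ℝ, 0 < r →
        DifferentiableAt ℝ F r ∧
        -(p - 1) * deriv F r +
            ((p + α) * ((N : ℝ) * p + p * α - p - α) / p ^ 2) *
              r ^ ((N : ℝ) - 3) * (-(deriv (Urad N p α) r)) ^ (p - 2) * g r =
          (pS N p α - 1) * r ^ ((N : ℝ) + α - 1) * (Urad N p α r) ^ (pS N p α - 2) * g r := by
  intro g F hg hF r hr
  have hp0 : 0 < p := by linarith
  have hp : 0 < p - 1 := by linarith
  have hNp : 0 < (N : ℝ) - p := by linarith
  have hpα : 0 < p + α := by linarith
  have hNα : 0 < (N : ℝ) + α := by linarith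
  have hC := Cnpa_pos hp1 hpN hα
  have hCpow := Cnpa_rpow_pS_sub hp1 hpN hα
  set n : ℝ := (N : ℝ)
  set C := Cnpa n p α with hCdef
  set m : ℝ := (n - p) / (p - 1) with hm
  set b : ℝ := (p + α) / (p - 1) with hb
  set a : ℝ := (p + α) / (p * (p - 1)) with ha
  set k : ℝ := (n + α) / (p + α) with hk
  set e : ℝ := n - 2 + (b - 1) * (p - 2) + a with he
  set l : ℝ := -(k * (p - 1)) - 1 with hl
  have hm0 : 0 < m := by positivity
  have hU : ∀ x : ℝ, 0 < x →
      -(deriv (Urad n p α) x) = C * m * (x ^ (b - 1) * (1 + x ^ b) ^ (-k)) := by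
    intro x hx
    rw [deriv_Urad hp1 hα hx, neg_neg]
  have hFeq : ∀ x : ℝ, 0 < x → F x = (C * m) ^ (p - 2) *
      (a * (x ^ e * (1 + x ^ b) ^ l) + (a - k * b) * (x ^ (e + b) * (1 + x ^ b) ^ l)) := by
    intro x hx
    have hg' := (hasDerivAt_rpow_mul_one_add_rpow b a (-k) hx).deriv
    rw [← hg] at hg'
    rw [hF]
    simp only []
    rw [hU x hx, hg', flux_eq n p a b k (C * m) (by positivity) hx]
  have hFd := ((((hasDerivAt_rpow_mul_one_add_rpow b e l hr).const_mul a).add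
    ((hasDerivAt_rpow_mul_one_add_rpow b (e + b) l hr).const_mul (a - k * b))).const_mul
      ((C * m) ^ (p - 2))).congr_of_eventuallyEq
        ((eventually_gt_nhds hr).mono fun x hx => hFeq x hx)
  refine ⟨hFd.differentiableAt, ?_⟩
  rw [hFd.deriv, hU r hr]
  have hs : 0 < 1 + r ^ b := by positivity
  have hgr : g r = r ^ a * (1 + r ^ b) ^ (-k) := by rw [hg]
  have hUr : Urad n p α r = C * (1 + r ^ b) ^ (-((n - p) / (p + α))) := rfl
  have hCS : C ^ (pS n p α - 2) = (n + α) * m * (C ^ (p - 2) * m ^ (p - 2)) := by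
    have h1 : pS n p α - 2 = (pS n p α - p) + (p - 2) := by ring
    have h2 : m ^ (p - 1) = m * m ^ (p - 2) := by
      rw [mul_comm, ← Real.rpow_add_one hm0.ne']; ring_nf
    rw [h1, Real.rpow_add hC, hCpow, h2]
    ring
  have hR : r ^ (n + α - 1) * r ^ a = r ^ (e - 1) * r ^ b := by
    rw [← Real.rpow_add hr, ← Real.rpow_add hr]
    congr 1
    rw [he, hb]
    field_simp
    ring
  have hR' : r ^ (n - 3) * r ^ ((b - 1) * (p - 2)) * r ^ a = r ^ (e - 1) := by
    rw [← Real.rpow_add hr, ← Real.rpow_add hr]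
    congr 1
    rw [he]
    ring
  have hS : (1 + r ^ b) ^ (-((n - p) / (p + α)) * (pS n p α - 2)) * (1 + r ^ b) ^ (-k) =
      (1 + r ^ b) ^ (l - 1) := by
    rw [← Real.rpow_add hs]
    congr 1
    rw [hl, hk, pS]
    field_simp
    ring
  have hS' : (1 + r ^ b) ^ (-k * (p - 2)) * (1 + r ^ b) ^ (-k) =
      (1 + r ^ b) ^ (l - 1) * (1 + r ^ b) ^ 2 := by
    rw [← Real.rpow_add hs, ← Real.rpow_natCast, ← Real.rpow_add hs]
    congr 1
    rw [hl]
    push_cast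
    ring
  have heb : r ^ (e + b - 1) = r ^ (e - 1) * r ^ b := by
    rw [← Real.rpow_add hr]; ring_nf
  rw [hgr, hUr, Real.mul_rpow hC.le (by positivity), Real.mul_rpow (by positivity) (by positivity),
    Real.mul_rpow (by positivity) (by positivity),
    Real.mul_rpow (by positivity) (by positivity), Real.mul_rpow (by positivity) (by positivity),
    ← Real.rpow_mul hr.le, ← Real.rpow_mul hs.le, ← Real.rpow_mul hs.le, hCS, heb]
  have key : -(p - 1) * (a * (e * (1 + r ^ b) + l * b * r ^ b) +
        (a - k * b) * r ^ b * ((e + b) * (1 + r ^ b) + l * b * r ^ b)) +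
      ((p + α) * (n * p + p * α - p - α) / p ^ 2) * (1 + r ^ b) ^ 2 =
      (pS n p α - 1) * (n + α) * m * r ^ b := by
    generalize r ^ b = t
    rw [he, hl, hk, hb, ha, hm, pS]
    field_simp
    ring
  linear_combination (C ^ (p - 2) * m ^ (p - 2) * r ^ (e - 1) * (1 + r ^ b) ^ (l - 1)) * key +
    ((p + α) * (n * p + p * α - p - α) / p ^ 2) * (C ^ (p - 2) * m ^ (p - 2)) *
      ((1 + r ^ b) ^ (-k * (p - 2)) * (1 + r ^ b) ^ (-k) * hR' + r ^ (e - 1) * hS') -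
    (pS n p α - 1) * ((n + α) * m * (C ^ (p - 2) * m ^ (p - 2))) *
      ((1 + r ^ b) ^ (-((n - p) / (p + α)) * (pS n p α - 2)) * (1 + r ^ b) ^ (-k) * hR +
        r ^ (e - 1) * r ^ b * hS)
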